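/- (General Seress Lemma) Let a ∈ A be an axis of type (λ,δ). Then for every x ∈ A and every y ∈ F·a + A_0(L_a), writing x = α_x·a + x_0 + x_λ and y = α_y·a + y_0 with x_0, y_0 ∈ A_0(L_a), x_λ ∈ A_λ(L_a), one has a·(x·y) = (a·x)·y + a·(x_0·y_0); in particular a·(x·y) − (a·x)·y ∈ F·a. -/

import Mathlib

/-! Common definitions: eigenspaces of left/right multiplication, axes, Jordan axes,
in a not-necessarily-associative, not-necessarily-commutative, not-necessarily-unital
algebra `A` over a field `F`. -/

variable (F : Type*) [Field F]
variable (A : Type*) [NonUnitalNonAssocRing A] [Module F A]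
  [SMulCommClass F A A] [IsScalarTower F A A]

/-- `leftEig F A a l = A_l(L_a) = {v : A | a * v = l • v}`, as a submodule of `A`. -/
def leftEig (a : A) (l : F) : Submodule F A where
  carrier := {v | a * v = l • v}
  add_mem' := by
    intro x y hx hy
    simp only [Set.mem_setOf_eq] at *
    rw [mul_add, hx, hy, smul_add]
  zero_mem' := by simp
  smul_mem' := by
    intro c x hx
    simp only [Set.mem_setOf_eq] at *
    rw [mul_smul_comm, hx, smul_comm]

/-- `rightEig F A a l = A_l(R_a) = {v : A | v * a = l • v}`, as a submodule of `A`. -/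
def rightEig (a : A) (l : F) : Submodule F A where
  carrier := {v | v * a = l • v}
  add_mem' := by
    intro x y hx hy
    simp only [Set.mem_setOf_eq] at *
    rw [add_mul, hx, hy, smul_add]
  zero_mem' := by simp
  smul_mem' := by
    intro c x hx
    simp only [Set.mem_setOf_eq] at *
    rw [smul_mul_assoc, hx, smul_comm]

/-- `eig2 F A a l d = A_{l,d}(a) = A_l(L_a) ⊓ A_d(R_a)`. -/
def eig2 (a : A) (l d : F) : Submodule F A :=
  leftEig F A a l ⊓ rightEig F A a d

/-- `a` is a left axis of type `l` (with `l ∉ {0,1}`):  an absolutely primitive idempotent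
whose left multiplication operator satisfies `(L_a - l)(L_a - 1)L_a = 0`, such that the
eigenspace decomposition `A = A_0(L_a) ⊕ A_1(L_a) ⊕ A_l(L_a)` is a ℤ/2-grading with
plus part `A_0(L_a) ⊕ A_1(L_a)` and minus part `A_l(L_a)`. -/
structure IsLeftAxis (l : F) (a : A) : Prop where
  l_ne_zero : l ≠ 0
  l_ne_one : l ≠ 1
  idem : a * a = a
  prim : leftEig F A a 1 = Submodule.span F {a}
  cube : ∀ v : A, a * (a * (a * v)) - a * (a * v) - l • (a * (a * v)) + l • (a * v) = 0
  decomp : leftEig F A a 0 ⊔ leftEig F A a 1 ⊔ leftEig F A a l = ⊤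
  fusePP : ∀ x ∈ leftEig F A a 0 ⊔ leftEig F A a 1, ∀ y ∈ leftEig F A a 0 ⊔ leftEig F A a 1,
      x * y ∈ leftEig F A a 0 ⊔ leftEig F A a 1
  fusePM : ∀ x ∈ leftEig F A a 0 ⊔ leftEig F A a 1, ∀ y ∈ leftEig F A a l,
      x * y ∈ leftEig F A a l
  fuseMP : ∀ x ∈ leftEig F A a l, ∀ y ∈ leftEig F A a 0 ⊔ leftEig F A a 1,
      x * y ∈ leftEig F A a l
  fuseMM : ∀ x ∈ leftEig F A a l, ∀ y ∈ leftEig F A a l,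
      x * y ∈ leftEig F A a 0 ⊔ leftEig F A a 1

/-- `a` is a right axis of type `d`: the symmetric notion with `R_a` in place of `L_a`. -/
structure IsRightAxis (d : F) (a : A) : Prop where
  d_ne_zero : d ≠ 0
  d_ne_one : d ≠ 1
  idem : a * a = a
  prim : rightEig F A a 1 = Submodule.span F {a}
  cube : ∀ v : A, v * a * a * a - v * a * a - d • (v * a * a) + d • (v * a) = 0
  decomp : rightEig F A a 0 ⊔ rightEig F A a 1 ⊔ rightEig F A a d = ⊤
  fusePP : ∀ x ∈ rightEig F A a 0 ⊔ rightEig F A a 1, ∀ y ∈ rightEig F A a 0 ⊔ rightEig F A a 1,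
      x * y ∈ rightEig F A a 0 ⊔ rightEig F A a 1
  fusePM : ∀ x ∈ rightEig F A a 0 ⊔ rightEig F A a 1, ∀ y ∈ rightEig F A a d,
      x * y ∈ rightEig F A a d
  fuseMP : ∀ x ∈ rightEig F A a d, ∀ y ∈ rightEig F A a 0 ⊔ rightEig F A a 1,
      x * y ∈ rightEig F A a d
  fuseMM : ∀ x ∈ rightEig F A a d, ∀ y ∈ rightEig F A a d,
      x * y ∈ rightEig F A a 0 ⊔ rightEig F A a 1

/-- `a` is a (two-sided) axis of type `(l, d)`. -/
structure IsAxis (l d : F) (a : A) : Prop where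
  toLeft : IsLeftAxis F A l a
  toRight : IsRightAxis F A d a
  comm : ∀ v : A, a * (v * a) = (a * v) * a

/-- `a` is an axis of Jordan type `(l, d)`: an axis of type `(l, d)` with
`A_{l,0}(a) = A_{0,d}(a) = 0`, so that `A = F·a ⊕ A_{0,0}(a) ⊕ A_{l,d}(a)`. -/
structure IsJordanAxis (l d : F) (a : A) extends IsAxis F A l d a : Prop where
  j_left : eig2 F A a l 0 = ⊥
  j_right : eig2 F A a 0 d = ⊥

theorem mem_leftEig {a v : A} {l : F} : v ∈ leftEig F A a l ↔ a * v = l • v := Iff.rfl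

/-- Left multiplication by an axis maps the plus part into the line spanned by the axis. -/
theorem IsLeftAxis.exists_mul_eq_smul {l : F} {a : A} (ha : IsLeftAxis F A l a) {z : A}
    (hz : z ∈ leftEig F A a 0 ⊔ leftEig F A a 1) : ∃ c : F, a * z = c • a := by
  obtain ⟨u, hu, v, hv, rfl⟩ := Submodule.mem_sup.1 hz
  rw [ha.prim] at hv
  obtain ⟨c, rfl⟩ := Submodule.mem_span_singleton.1 hv
  rw [mem_leftEig] at hu
  exact ⟨c, by rw [mul_add, hu, zero_smul, zero_add, mul_smul_comm, ha.idem]⟩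

/-- General Seress Lemma: if `a` is an axis of type `(l, d)`,
`x = αx • a + x₀ + xλ` with `x₀ ∈ A_0(L_a)`, `xλ ∈ A_l(L_a)`, and `y = αy • a + y₀`
with `y₀ ∈ A_0(L_a)`, then `a*(x*y) = (a*x)*y + a*(x₀*y₀)`; in particular
`a*(x*y) - (a*x)*y ∈ F·a`. -/
theorem general_seress (hchar : (2 : F) ≠ 0) (l d : F) (a : A) (ha : IsAxis F A l d a)
    (x y : A) (αx αy : F) (x0 xl y0 : A)
    (hx0 : x0 ∈ leftEig F A a 0) (hxl : xl ∈ leftEig F A a l)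
    (hy0 : y0 ∈ leftEig F A a 0)
    (hxdec : x = αx • a + x0 + xl) (hydec : y = αy • a + y0) :
    a * (x * y) = (a * x) * y + a * (x0 * y0) ∧
    ∃ c : F, a * (x * y) - (a * x) * y = c • a := by
  have hL := ha.toLeft
  have haa : a * a = a := hL.idem
  have ha1 : a ∈ leftEig F A a 1 := by rw [mem_leftEig, haa, one_smul]
  have hy : y ∈ leftEig F A a 0 ⊔ leftEig F A a 1 := by
    rw [hydec]
    exact add_mem (Submodule.mem_sup_right (Submodule.smul_mem _ _ ha1))
      (Submodule.mem_sup_left hy0)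
  have hlam : a * (xl * y) = (a * xl) * y := by
    have h := hL.fuseMP xl hxl y hy
    rw [mem_leftEig] at h hxl
    rw [h, hxl, smul_mul_assoc]
  obtain ⟨c, hc⟩ := hL.exists_mul_eq_smul F A
    (hL.fusePP x0 (Submodule.mem_sup_left hx0) y0 (Submodule.mem_sup_left hy0))
  rw [mem_leftEig, zero_smul] at hx0 hy0
  have hzero : a * (x0 * y) = a * (x0 * y0) := by
    rw [hydec, mul_add, mul_add, mul_smul_comm, mul_smul_comm, ha.comm, hx0, zero_mul,
      smul_zero, zero_add]
  have hay : a * y = αy • a := by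
    rw [hydec, mul_add, mul_smul_comm, haa, hy0, add_zero]
  have key : a * (x * y) = (a * x) * y + a * (x0 * y0) := by
    rw [hxdec]
    simp only [mul_add, add_mul, mul_smul_comm, smul_mul_assoc, hlam, hzero, hay, hx0, haa,
      zero_mul]
    abel
  exact ⟨key, c, by rw [key, add_sub_cancel_left, hc]⟩
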